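/- arXiv:2109.08531 — 4 statements merged into one kernel-verified Lean document; each statement's English description precedes it below -/
import Mathlib

section
/- Let n ≥ 3 be odd, p = (n−1)/2, λ > 0 and b₁,…,b_p ∈ ℝ with every b_i ≠ 0. Let F be the endomorphism of ℝ^{n+2} defined by F(e₀) = F(e₁) = (1/(2√λ)) e₂, F(e₂) = (1/(2√λ))(e₀ − e₁), and, for i = 1,…,p, F(e_{2i+1}) = b_i e_{2i+2} and F(e_{2i+2}) = −b_i e_{2i+1}. Then F is η-skew-symmetric, ker F = span{e₀ − e₁} so that the restriction of η to ker F is degenerate (e₀ − e₁ is a null vector in ker F), and the characteristic polynomial of −F² equals X³ ∏_{i=1}^{p} (X − b_i²)². -/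
open Polynomial

/-- The Minkowski bilinear form of signature `(1, n+1)` on `ℝ^{n+2}`. -/
noncomputable def mink (n : ℕ) (u v : Fin (n + 2) → ℝ) : ℝ :=
  -(u 0 * v 0) + ∑ k : Fin (n + 1), u k.succ * v k.succ

/-- The decomposition of the index set of `ℝ^{2p+3}` into the three indices `0, 1, 2` and the
`p` pairs `(2i + 3, 2i + 4)`. -/
noncomputable def indexEquiv (p : ℕ) : Fin 3 ⊕ Fin 2 × Fin p ≃ Fin (2 * p + 1 + 2) :=
  Equiv.ofBijective
    (Sum.elim (fun i => ⟨i, by omega⟩) (fun x => ⟨2 * x.2 + 3 + x.1, by omega⟩)) <| by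
    rw [Fintype.bijective_iff_injective_and_card]
    constructor
    · rintro (i | ⟨i, j⟩) (k | ⟨k, l⟩) h <;>
        simp only [Sum.elim_inl, Sum.elim_inr, Fin.mk.injEq] at h <;>
        simp only [Sum.inl.injEq, Sum.inr.injEq, Prod.mk.injEq, Fin.ext_iff, reduceCtorEq] <;>
        omega
    · simp
      ring

@[simp]
lemma indexEquiv_inl_zero (p : ℕ) : indexEquiv p (Sum.inl 0) = 0 := rfl

@[simp]
lemma indexEquiv_inl_one (p : ℕ) : indexEquiv p (Sum.inl 1) = 1 := by
  apply Fin.ext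
  simp [indexEquiv]

@[simp]
lemma indexEquiv_inl_two (p : ℕ) (hp : 1 ≤ p) : indexEquiv p (Sum.inl 2) = 2 := by
  apply Fin.ext
  simp [indexEquiv, Nat.mod_eq_of_lt (show 2 < 2 * p + 1 + 2 by omega)]

lemma indexEquiv_inr_zero (p : ℕ) (i : Fin p) :
    indexEquiv p (Sum.inr (0, i)) = ⟨2 * (i : ℕ) + 3, by omega⟩ := rfl

lemma indexEquiv_inr_one (p : ℕ) (i : Fin p) :
    indexEquiv p (Sum.inr (1, i)) = ⟨2 * (i : ℕ) + 4, by omega⟩ := rfl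

/-- The normal form of the skew-symmetric endomorphism, in block-diagonal shape. -/
def blockForm {p : ℕ} (c : ℝ) (b : Fin p → ℝ) :
    Matrix (Fin 3 ⊕ Fin 2 × Fin p) (Fin 3 ⊕ Fin 2 × Fin p) ℝ :=
  Matrix.fromBlocks !![0, 0, c; 0, 0, -c; c, c, 0] 0 0
    (Matrix.blockDiagonal fun i => !![0, -b i; b i, 0])

lemma blockForm_mulVec {p : ℕ} (c : ℝ) (b : Fin p → ℝ) (u : Fin 3 ⊕ Fin 2 × Fin p → ℝ) :
    (blockForm c b).mulVec u =
      Sum.elim ![c * u (Sum.inl 2), -c * u (Sum.inl 2), c * (u (Sum.inl 0) + u (Sum.inl 1))]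
        (fun x => ![-b x.2 * u (Sum.inr (1, x.2)), b x.2 * u (Sum.inr (0, x.2))] x.1) := by
  ext (i | ⟨k, i⟩)
  · fin_cases i <;>
      simp [blockForm, Matrix.mulVec, dotProduct, Fin.sum_univ_three, mul_add]
  · fin_cases k <;>
      simp [blockForm, Matrix.mulVec, dotProduct, Fintype.sum_prod_type, Fin.sum_univ_two,
        Matrix.blockDiagonal_apply]

lemma charpoly_neg_blockForm_sq {p : ℕ} (c : ℝ) (b : Fin p → ℝ) :
    (-(blockForm c b * blockForm c b)).charpoly = X ^ 3 * ∏ i, (X - C (b i ^ 2)) ^ 2 := by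
  have hB : (-(Matrix.blockDiagonal (fun i => !![0, -b i; b i, 0]) *
      Matrix.blockDiagonal fun i => !![0, -b i; b i, 0]) :
        Matrix (Fin 2 × Fin p) (Fin 2 × Fin p) ℝ) =
      Matrix.diagonal fun x => b x.2 ^ 2 := by
    rw [← Matrix.blockDiagonal_mul, ← Matrix.blockDiagonal_neg]
    ext ⟨k, i⟩ ⟨l, j⟩
    fin_cases k <;> fin_cases l <;>
      simp [Matrix.blockDiagonal_apply, Matrix.diagonal_apply, sq]
  have hA : (-(!![0, 0, c; 0, 0, -c; c, c, 0] * !![0, 0, c; 0, 0, -c; c, c, 0]) :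
      Matrix (Fin 3) (Fin 3) ℝ).charpoly = X ^ 3 := by
    simp [Matrix.charpoly, Matrix.det_fin_three]
    ring
  unfold blockForm
  rw [Matrix.fromBlocks_multiply, Matrix.fromBlocks_neg]
  simp only [Matrix.mul_zero, Matrix.zero_mul, add_zero, zero_add, neg_zero]
  rw [Matrix.charpoly_fromBlocks_zero₁₂, hA, hB, Matrix.charpoly_diagonal,
    Fintype.prod_prod_type_right]
  simp

lemma mink_eq (p : ℕ) (hp : 1 ≤ p) (u v : Fin (2 * p + 1 + 2) → ℝ) :
    mink (2 * p + 1) u v = -(u 0 * v 0) + u 1 * v 1 + u 2 * v 2 +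
      ∑ i : Fin p, (u (indexEquiv p (Sum.inr (0, i))) * v (indexEquiv p (Sum.inr (0, i))) +
        u (indexEquiv p (Sum.inr (1, i))) * v (indexEquiv p (Sum.inr (1, i)))) := by
  have h := Fin.sum_univ_succ fun k => u k * v k
  rw [← (indexEquiv p).sum_comp] at h
  simp only [Fintype.sum_sum_type, Fin.sum_univ_three, indexEquiv_inl_zero, indexEquiv_inl_one,
    indexEquiv_inl_two p hp, Fintype.sum_prod_type_right, Fin.sum_univ_two] at h
  rw [mink]
  linarith

/-- for `n = 2p + 1` odd (`n ≥ 3`), `λ > 0`, all `bᵢ ≠ 0`, and `F` defined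
by `F(e₀) = F(e₁) = (1/(2√λ)) e₂`, `F(e₂) = (1/(2√λ))(e₀ − e₁)`,
`F(e_{2i+1}) = bᵢ e_{2i+2}`, `F(e_{2i+2}) = −bᵢ e_{2i+1}` (`i = 1,…,p`): `F` is
`η`-skew-symmetric, `ker F = span{e₀ − e₁}` so that `η` restricted to `ker F` is
degenerate (`e₀ − e₁` is a null vector in `ker F`), and the characteristic polynomial
of `−F²` equals `X³ ∏ᵢ (X − bᵢ²)²`. -/
theorem stmt13 (p : ℕ) (hp : 1 ≤ p) (n : ℕ) (hn : n = 2 * p + 1)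
    (lam : ℝ) (hlam : 0 < lam) (b : Fin p → ℝ) (hb : ∀ i, b i ≠ 0)
    (F : Matrix (Fin (n + 2)) (Fin (n + 2)) ℝ)
    (hF0 : F.mulVec (Pi.single 0 1)
      = (1 / (2 * Real.sqrt lam)) • (Pi.single 2 1 : Fin (n + 2) → ℝ))
    (hF1 : F.mulVec (Pi.single 1 1)
      = (1 / (2 * Real.sqrt lam)) • (Pi.single 2 1 : Fin (n + 2) → ℝ))
    (hF2 : F.mulVec (Pi.single 2 1)
      = (1 / (2 * Real.sqrt lam)) •
          ((Pi.single 0 1 : Fin (n + 2) → ℝ) - Pi.single 1 1))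
    (hFx : ∀ i : Fin p,
      F.mulVec (Pi.single ⟨2 * (i : ℕ) + 3, by have := i.isLt; omega⟩ 1)
        = b i • (Pi.single ⟨2 * (i : ℕ) + 4, by have := i.isLt; omega⟩ 1 :
            Fin (n + 2) → ℝ))
    (hFy : ∀ i : Fin p,
      F.mulVec (Pi.single ⟨2 * (i : ℕ) + 4, by have := i.isLt; omega⟩ 1)
        = (-(b i)) • (Pi.single ⟨2 * (i : ℕ) + 3, by have := i.isLt; omega⟩ 1 :
            Fin (n + 2) → ℝ)) :
    (∀ u v, mink n (F.mulVec u) v + mink n u (F.mulVec v) = 0) ∧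
    LinearMap.ker F.mulVecLin
      = Submodule.span ℝ {(Pi.single 0 1 : Fin (n + 2) → ℝ) - Pi.single 1 1} ∧
    ((Pi.single 0 1 : Fin (n + 2) → ℝ) - Pi.single 1 1) ∈ LinearMap.ker F.mulVecLin ∧
    ((Pi.single 0 1 : Fin (n + 2) → ℝ) - Pi.single 1 1) ≠ 0 ∧
    mink n ((Pi.single 0 1 : Fin (n + 2) → ℝ) - Pi.single 1 1)
      ((Pi.single 0 1 : Fin (n + 2) → ℝ) - Pi.single 1 1) = 0 ∧
    (∀ w ∈ LinearMap.ker F.mulVecLin,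
      mink n ((Pi.single 0 1 : Fin (n + 2) → ℝ) - Pi.single 1 1) w = 0) ∧
    (-(F * F)).charpoly = X ^ 3 * ∏ i : Fin p, (X - C (b i ^ 2)) ^ 2 := by
  subst hn
  have hc : 1 / (2 * Real.sqrt lam) ≠ 0 := by positivity
  generalize 1 / (2 * Real.sqrt lam) = c at hF0 hF1 hF2 hc
  simp only [← indexEquiv_inr_zero, ← indexEquiv_inr_one] at hFx hFy
  have h0 := indexEquiv_inl_zero p
  have h1 := indexEquiv_inl_one p
  have h2 := indexEquiv_inl_two p hp
  have hF : F.submatrix (indexEquiv p) (indexEquiv p) = blockForm c b := by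
    rw [← h0, ← h2] at hF0
    rw [← h1, ← h2] at hF1
    rw [← h0, ← h1, ← h2] at hF2
    simp only [Matrix.mulVec_single_one, funext_iff, Matrix.col_apply, Pi.smul_apply,
      Pi.sub_apply] at hF0 hF1 hF2 hFx hFy
    ext x (j | ⟨l, j⟩)
    · rcases x with i | x
      · fin_cases j <;> fin_cases i <;>
          simp [-indexEquiv_inl_zero, -indexEquiv_inl_one, hF0, hF1, hF2, blockForm]
      · fin_cases j <;>
          simp [-indexEquiv_inl_zero, -indexEquiv_inl_one, hF0, hF1, hF2, blockForm]
    · rcases x with i | ⟨k, i⟩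
      · fin_cases l <;>
          simp [-indexEquiv_inl_zero, -indexEquiv_inl_one, hFx, hFy, blockForm]
      · fin_cases l <;> fin_cases k <;>
          simp +contextual [hFx, hFy, blockForm, Pi.single_apply, Matrix.blockDiagonal_apply]
  have hmul (u : Fin (2 * p + 1 + 2) → ℝ) (x) : F.mulVec u (indexEquiv p x) =
      (blockForm c b).mulVec (u ∘ indexEquiv p) x := by
    rw [← hF, Matrix.submatrix_mulVec_equiv]
    simp [Function.comp_assoc]
  have e0 (u) : F.mulVec u 0 = c * u 2 := by
    rw [← h0, hmul, blockForm_mulVec]; simp [h2]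
  have e1 (u) : F.mulVec u 1 = -c * u 2 := by
    rw [← h1, hmul, blockForm_mulVec]; simp [h2]
  have e2 (u) : F.mulVec u 2 = c * (u 0 + u 1) := by
    rw [← h2, hmul, blockForm_mulVec]; simp
  have ex (u) (i) : F.mulVec u (indexEquiv p (Sum.inr (0, i))) =
      -b i * u (indexEquiv p (Sum.inr (1, i))) := by
    rw [hmul, blockForm_mulVec]; simp
  have ey (u) (i) : F.mulVec u (indexEquiv p (Sum.inr (1, i))) =
      b i * u (indexEquiv p (Sum.inr (0, i))) := by
    rw [hmul, blockForm_mulVec]; simp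
  have hmem : ((Pi.single 0 1 : Fin (2 * p + 1 + 2) → ℝ) - Pi.single 1 1) ∈
      LinearMap.ker F.mulVecLin := by
    rw [LinearMap.mem_ker, Matrix.mulVecLin_apply, Matrix.mulVec_sub, hF0, hF1, sub_self]
  have hskew (u v) : mink (2 * p + 1) (F.mulVec u) v + mink (2 * p + 1) u (F.mulVec v) = 0 := by
    simp only [mink_eq p hp, e0, e1, e2, ex, ey]
    have : ∀ s t a d : ℝ, s + t = 0 → a + d = 0 → a + s + (d + t) = 0 := by
      intros; linarith
    apply this
    · rw [← Finset.sum_add_distrib]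
      exact Finset.sum_eq_zero fun i _ => by ring
    · ring
  have hker {w} (hw : w ∈ LinearMap.ker F.mulVecLin) : w 0 + w 1 = 0 ∧ w 2 = 0 ∧
      ∀ x, w (indexEquiv p (Sum.inr x)) = 0 := by
    rw [LinearMap.mem_ker, Matrix.mulVecLin_apply] at hw
    refine ⟨?_, ?_, ?_⟩
    · simpa [hw, hc] using (e2 w).symm
    · simpa [hw, hc] using (e0 w).symm
    · rintro ⟨k, i⟩
      fin_cases k
      · simpa [hw, hb i] using (ey w i).symm
      · simpa [hw, hb i] using (ex w i).symm
  have h10 : (1 : Fin (2 * p + 1 + 2)) ≠ 0 := by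
    rw [← h0, ← h1]; simp [-indexEquiv_inl_zero, -indexEquiv_inl_one]
  have hspan : LinearMap.ker F.mulVecLin =
      Submodule.span ℝ {(Pi.single 0 1 : Fin (2 * p + 1 + 2) → ℝ) - Pi.single 1 1} := by
    apply le_antisymm
    · intro w hw
      obtain ⟨w01, w2, wr⟩ := hker hw
      rw [Submodule.mem_span_singleton]
      refine ⟨w 0, ?_⟩
      ext x
      obtain ⟨x, rfl⟩ := (indexEquiv p).surjective x
      rw [← h0, ← h1] at w01 ⊢
      rw [← h2] at w2
      rcases x with i | x
      · fin_cases i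
        · simp [-indexEquiv_inl_zero, -indexEquiv_inl_one]
        · simp [-indexEquiv_inl_zero, -indexEquiv_inl_one]
          linarith
        · simp [-indexEquiv_inl_zero, -indexEquiv_inl_one, w2]
      · simp [-indexEquiv_inl_zero, -indexEquiv_inl_one, wr]
    · rwa [Submodule.span_singleton_le_iff_mem]
  have hpair (w) (hw : w ∈ LinearMap.ker F.mulVecLin) :
      mink (2 * p + 1) ((Pi.single 0 1 : Fin (2 * p + 1 + 2) → ℝ) - Pi.single 1 1) w = 0 := by
    obtain ⟨w01, w2, wr⟩ := hker hw
    simp only [mink_eq p hp, w2, wr]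
    simp [h10, h10.symm]
    linarith
  refine ⟨hskew, hspan, hmem, ?_, hpair _ hmem, hpair, ?_⟩
  · intro h
    simpa [h10.symm] using congrFun h 0
  · rw [← charpoly_neg_blockForm_sq c b, ← hF, Matrix.submatrix_mul_equiv,
      ← Matrix.charpoly_reindex (indexEquiv p).symm]
    rfl
end

section
/- Fix an integer q ≥ 1 and λ > 0. On the open set of (t, β, φ) ∈ ℝ × (ℝ^q \ {0}) × ℝ^q, set W := ∑_{i=1}^q β_i² and define Φ : ℝ × (ℝ^q \ {0}) × ℝ^q → ℝ^{2q} by Φ(t, β, φ) = (x₁, y₁, …, x_q, y_q) with x_i = e^{√λ t} W^{−1/2} β_i cos φ_i and y_i = e^{√λ t} W^{−1/2} β_i sin φ_i. Then Φ is differentiable and for every point and every vector v = (v_t, v_β, v_φ) ∈ ℝ × ℝ^q × ℝ^q, the Euclidean square norm of the directional derivative satisfies |DΦ(v)|² = e^{2√λ t} W^{−1} [ λ W v_t² + ∑_{i=1}^q ( v_{β_i}² + β_i² v_{φ_i}² ) − (∑_{i=1}^q β_i v_{β_i})² / W ]. -/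
theorem hasDerivAt_add_mul (x y : ℝ) : HasDerivAt (fun s : ℝ => x + s * y) y 0 := by
  simpa using ((hasDerivAt_id (0 : ℝ)).mul_const y).const_add x

/-- The derivative of `s ↦ e^{c (t + s a)} / √(∑ (βⱼ + s bⱼ)²)` at `s = 0` is its value times
`c a - (∑ βⱼ bⱼ) / ∑ βⱼ²`. -/
theorem hasDerivAt_exp_div_sqrt_sum_sq {ι : Type*} [Fintype ι] (c t a : ℝ) (β b : ι → ℝ)
    (hW : 0 < ∑ j, β j ^ 2) :
    HasDerivAt (fun s : ℝ => Real.exp (c * (t + s * a)) / Real.sqrt (∑ j, (β j + s * b j) ^ 2))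
      (Real.exp (c * t) / Real.sqrt (∑ j, β j ^ 2) *
        (c * a - (∑ j, β j * b j) / ∑ j, β j ^ 2)) 0 := by
  have hexp := ((hasDerivAt_add_mul t a).const_mul c).exp
  have hsum : HasDerivAt (fun s : ℝ => ∑ j, (β j + s * b j) ^ 2) (2 * ∑ j, β j * b j) 0 := by
    refine (HasDerivAt.fun_sum fun j _ => (hasDerivAt_add_mul (β j) (b j)).fun_pow 2).congr_deriv ?_
    rw [Finset.mul_sum]
    refine Finset.sum_congr rfl fun j _ => ?_
    simp
    ring
  have hsqrt := hsum.sqrt (by simpa using hW.ne')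
  have hpos := Real.sqrt_pos.2 hW
  have hsq := Real.sq_sqrt hW.le
  refine (hexp.fun_div hsqrt (by simpa using hpos.ne')).congr_deriv ?_
  simp only [zero_mul, add_zero]
  generalize Real.sqrt (∑ j, β j ^ 2) = r at *
  rw [← hsq]
  field_simp

/-- For a curve given in polar coordinates with radii `r βᵢ`, radial velocities `r k βᵢ + r bᵢ`
and angular velocities `pᵢ`, the square norm of the Cartesian velocity is the sum of the squared
radial velocities and the squared `r βᵢ pᵢ`. -/
theorem sum_sq_polar_velocity {ι : Type*} [Fintype ι] (r k : ℝ) (β b φ p : ι → ℝ) :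
    ∑ i, (((r * k * β i + r * b i) * Real.cos (φ i) - r * β i * (Real.sin (φ i) * p i)) ^ 2 +
        ((r * k * β i + r * b i) * Real.sin (φ i) + r * β i * (Real.cos (φ i) * p i)) ^ 2) =
      r ^ 2 * (k ^ 2 * ∑ i, β i ^ 2 + 2 * k * ∑ i, β i * b i +
        ∑ i, (b i ^ 2 + β i ^ 2 * p i ^ 2)) := by
  simp only [mul_add, Finset.mul_sum, ← Finset.sum_add_distrib]
  refine Finset.sum_congr rfl fun i _ => ?_
  linear_combination
    ((r * k * β i + r * b i) ^ 2 + (r * β i * p i) ^ 2) * Real.sin_sq_add_cos_sq (φ i)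

/-- the map `Φ(t, β, φ) = (e^{√λ t} W^{-1/2} βᵢ cos φᵢ,
e^{√λ t} W^{-1/2} βᵢ sin φᵢ)` with `W = ∑ βᵢ²` is differentiable at every point with
`β ≠ 0`, and the Euclidean square norm of its directional derivative equals
`e^{2√λ t} W^{-1} (λ W v_t² + ∑ (v_{βᵢ}² + βᵢ² v_{φᵢ}²) − (∑ βᵢ v_{βᵢ})² / W)`. -/
theorem stmt14 (q : ℕ) (hq : 1 ≤ q) (lam : ℝ) (hlam : 0 < lam)
    (Φ : ℝ × (Fin q → ℝ) × (Fin q → ℝ) → (Fin q → ℝ) × (Fin q → ℝ))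
    (hΦ : ∀ P : ℝ × (Fin q → ℝ) × (Fin q → ℝ),
      Φ P = (fun i => Real.exp (Real.sqrt lam * P.1)
                / Real.sqrt (∑ j, P.2.1 j ^ 2) * P.2.1 i * Real.cos (P.2.2 i),
             fun i => Real.exp (Real.sqrt lam * P.1)
                / Real.sqrt (∑ j, P.2.1 j ^ 2) * P.2.1 i * Real.sin (P.2.2 i))) :
    ∀ (t : ℝ) (β φv : Fin q → ℝ), β ≠ 0 →
      DifferentiableAt ℝ Φ (t, β, φv) ∧
      ∀ v : ℝ × (Fin q → ℝ) × (Fin q → ℝ),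
        (∑ i, ((fderiv ℝ Φ (t, β, φv) v).1 i ^ 2 + (fderiv ℝ Φ (t, β, φv) v).2 i ^ 2))
        = Real.exp (2 * Real.sqrt lam * t) / (∑ i, β i ^ 2) *
            (lam * (∑ i, β i ^ 2) * v.1 ^ 2
              + (∑ i, (v.2.1 i ^ 2 + β i ^ 2 * v.2.2 i ^ 2))
              - (∑ i, β i * v.2.1 i) ^ 2 / (∑ i, β i ^ 2)) := by
  intro t β φv hβ
  obtain rfl : Φ = _ := funext hΦ
  have hW : 0 < ∑ j, β j ^ 2 := by
    obtain ⟨i, hi⟩ := Function.ne_iff.1 hβ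
    exact Finset.sum_pos' (fun j _ => sq_nonneg _) ⟨i, Finset.mem_univ i, sq_pos_of_ne_zero hi⟩
  have hr : Real.sqrt (∑ j, β j ^ 2) ≠ 0 := (Real.sqrt_pos.2 hW).ne'
  have hd : DifferentiableAt ℝ (fun P : ℝ × (Fin q → ℝ) × (Fin q → ℝ) =>
      ((fun i => Real.exp (Real.sqrt lam * P.1)
          / Real.sqrt (∑ j, P.2.1 j ^ 2) * P.2.1 i * Real.cos (P.2.2 i),
        fun i => Real.exp (Real.sqrt lam * P.1)
          / Real.sqrt (∑ j, P.2.1 j ^ 2) * P.2.1 i * Real.sin (P.2.2 i)) :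
        (Fin q → ℝ) × (Fin q → ℝ))) (t, β, φv) := by
    have hρ : DifferentiableAt ℝ (fun P : ℝ × (Fin q → ℝ) × (Fin q → ℝ) =>
        Real.exp (Real.sqrt lam * P.1) / Real.sqrt (∑ j, P.2.1 j ^ 2)) (t, β, φv) := by
      simp only [div_eq_mul_inv]
      exact DifferentiableAt.fun_mul (by fun_prop)
        (DifferentiableAt.fun_inv (DifferentiableAt.sqrt (by fun_prop) hW.ne') hr)
    exact DifferentiableAt.prodMk
      (differentiableAt_pi.2 fun i => (hρ.fun_mul (by fun_prop)).fun_mul (by fun_prop))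
      (differentiableAt_pi.2 fun i => (hρ.fun_mul (by fun_prop)).fun_mul (by fun_prop))
  refine ⟨hd, fun v => ?_⟩
  obtain ⟨a, b, p⟩ := v
  have hρ := hasDerivAt_exp_div_sqrt_sum_sq (Real.sqrt lam) t a β b hW
  have hL : HasDerivAt _ _ (0 : ℝ) := hd.hasFDerivAt.hasLineDerivAt (a, b, p)
  have hx (i : Fin q) := (hasDerivAt_pi.1 hL.fst i).unique
    ((hρ.fun_mul (hasDerivAt_add_mul (β i) (b i))).fun_mul (hasDerivAt_add_mul (φv i) (p i)).cos)
  have hy (i : Fin q) := (hasDerivAt_pi.1 hL.snd i).unique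
    ((hρ.fun_mul (hasDerivAt_add_mul (β i) (b i))).fun_mul (hasDerivAt_add_mul (φv i) (p i)).sin)
  simp only [zero_mul, zero_smul, add_zero] at hx hy
  simp only [hx, hy]
  have hexp : Real.exp (2 * Real.sqrt lam * t) = Real.exp (Real.sqrt lam * t) ^ 2 := by
    rw [← Real.exp_nat_mul]
    congr 1
    push_cast
    ring
  have key := sum_sq_polar_velocity (Real.exp (Real.sqrt lam * t) / Real.sqrt (∑ j, β j ^ 2))
    (Real.sqrt lam * a - (∑ j, β j * b j) / ∑ j, β j ^ 2) β b φv p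
  rw [div_pow, Real.sq_sqrt hW.le, ← hexp] at key
  refine (Finset.sum_congr rfl fun i _ => by ring).trans (key.trans ?_)
  congr 1
  have hlam' := Real.sq_sqrt hlam.le
  generalize Real.sqrt lam = c at *
  rw [← hlam']
  field_simp
  ring
end

section
/- Fix an integer p ≥ 1 and λ > 0, and set ρ := cos(√λ t) + cosh χ. On the set of points (t, χ, ν, φ) ∈ ℝ × ℝ × ℝ^p × ℝ^p with ∑_{i=1}^p ν_i² = 1 and ρ > 0, define Ψ = (z, x₁, y₁, …, x_p, y_p) ∈ ℝ^{2p+1} by z = sin(√λ t)/ρ, x_i = sinh χ · ν_i cos φ_i / ρ, y_i = sinh χ · ν_i sin φ_i / ρ. Then for every such point and every vector v = (v_t, v_χ, v_ν, v_φ) ∈ ℝ × ℝ × ℝ^p × ℝ^p satisfying ∑_{i=1}^p ν_i v_{ν_i} = 0 (tangent to the constraint ∑ν_i² = 1), the Euclidean square norm of the directional derivative satisfies |DΨ(v)|² = ρ^{−2} [ λ v_t² + v_χ² + sinh²χ ( ∑_{i=1}^p v_{ν_i}² + ∑_{i=1}^p ν_i² v_{φ_i}² ) ]. -/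
theorem hasDerivAt_conformalDenom (t χ k a b : ℝ) :
    HasDerivAt (fun s : ℝ => Real.cos (k * (t + s * a)) + Real.cosh (χ + s * b))
      (-Real.sin (k * t) * (k * a) + Real.sinh χ * b) 0 := by
  have ht : HasDerivAt (fun s : ℝ => k * (t + s * a)) (k * a) 0 := by
    simpa using (((hasDerivAt_id (0 : ℝ)).mul_const a).const_add t).const_mul k
  have hχ : HasDerivAt (fun s : ℝ => χ + s * b) b 0 := by
    simpa using ((hasDerivAt_id (0 : ℝ)).mul_const b).const_add χ
  simpa using ht.cos.fun_add hχ.cosh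

theorem hasDerivAt_sin_div (t χ k a b : ℝ) (h : Real.cos (k * t) + Real.cosh χ ≠ 0) :
    HasDerivAt (fun s : ℝ => Real.sin (k * (t + s * a))
        / (Real.cos (k * (t + s * a)) + Real.cosh (χ + s * b)))
      ((Real.cos (k * t) * (k * a) * (Real.cos (k * t) + Real.cosh χ)
        - Real.sin (k * t) * (-Real.sin (k * t) * (k * a) + Real.sinh χ * b))
        / (Real.cos (k * t) + Real.cosh χ) ^ 2) 0 := by
  have ht : HasDerivAt (fun s : ℝ => k * (t + s * a)) (k * a) 0 := by
    simpa using (((hasDerivAt_id (0 : ℝ)).mul_const a).const_add t).const_mul k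
  simpa using ht.sin.fun_div (hasDerivAt_conformalDenom t χ k a b) (by simpa using h)

theorem hasDerivAt_sinh_mul_div (t χ k a b n m : ℝ)
    (h : Real.cos (k * t) + Real.cosh χ ≠ 0) :
    HasDerivAt (fun s : ℝ => Real.sinh (χ + s * b) * (n + s * m)
        / (Real.cos (k * (t + s * a)) + Real.cosh (χ + s * b)))
      ((Real.cosh χ * b * (Real.cos (k * t) + Real.cosh χ)
        - Real.sinh χ * (-Real.sin (k * t) * (k * a) + Real.sinh χ * b))
        / (Real.cos (k * t) + Real.cosh χ) ^ 2 * n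
        + Real.sinh χ / (Real.cos (k * t) + Real.cosh χ) * m) 0 := by
  have hχ : HasDerivAt (fun s : ℝ => χ + s * b) b 0 := by
    simpa using ((hasDerivAt_id (0 : ℝ)).mul_const b).const_add χ
  have hn : HasDerivAt (fun s : ℝ => n + s * m) m 0 := by
    simpa using ((hasDerivAt_id (0 : ℝ)).mul_const m).const_add n
  refine ((hχ.sinh.fun_mul hn).fun_div (hasDerivAt_conformalDenom t χ k a b)
    (by simpa using h)).congr_deriv ?_
  simp
  field_simp
  ring

theorem hasDerivAt_sinh_mul_cos_div (t χ k a b n m q r : ℝ)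
    (h : Real.cos (k * t) + Real.cosh χ ≠ 0) :
    HasDerivAt (fun s : ℝ => Real.sinh (χ + s * b) * (n + s * m) * Real.cos (q + s * r)
        / (Real.cos (k * (t + s * a)) + Real.cosh (χ + s * b)))
      (((Real.cosh χ * b * (Real.cos (k * t) + Real.cosh χ)
        - Real.sinh χ * (-Real.sin (k * t) * (k * a) + Real.sinh χ * b))
        / (Real.cos (k * t) + Real.cosh χ) ^ 2 * n
        + Real.sinh χ / (Real.cos (k * t) + Real.cosh χ) * m) * Real.cos q
        - Real.sinh χ / (Real.cos (k * t) + Real.cosh χ) * n * r * Real.sin q) 0 := by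
  have hq : HasDerivAt (fun s : ℝ => q + s * r) r 0 := by
    simpa using ((hasDerivAt_id (0 : ℝ)).mul_const r).const_add q
  refine (((hasDerivAt_sinh_mul_div t χ k a b n m h).fun_mul hq.cos).congr_deriv ?_
    ).congr_of_eventuallyEq (Filter.Eventually.of_forall fun s => ?_)
  · simp
    ring
  · simp
    ring

theorem hasDerivAt_sinh_mul_sin_div (t χ k a b n m q r : ℝ)
    (h : Real.cos (k * t) + Real.cosh χ ≠ 0) :
    HasDerivAt (fun s : ℝ => Real.sinh (χ + s * b) * (n + s * m) * Real.sin (q + s * r)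
        / (Real.cos (k * (t + s * a)) + Real.cosh (χ + s * b)))
      (((Real.cosh χ * b * (Real.cos (k * t) + Real.cosh χ)
        - Real.sinh χ * (-Real.sin (k * t) * (k * a) + Real.sinh χ * b))
        / (Real.cos (k * t) + Real.cosh χ) ^ 2 * n
        + Real.sinh χ / (Real.cos (k * t) + Real.cosh χ) * m) * Real.sin q
        + Real.sinh χ / (Real.cos (k * t) + Real.cosh χ) * n * r * Real.cos q) 0 := by
  have hq : HasDerivAt (fun s : ℝ => q + s * r) r 0 := by
    simpa using ((hasDerivAt_id (0 : ℝ)).mul_const r).const_add q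
  refine (((hasDerivAt_sinh_mul_div t χ k a b n m h).fun_mul hq.sin).congr_deriv ?_
    ).congr_of_eventuallyEq (Filter.Eventually.of_forall fun s => ?_)
  · simp
    ring
  · simp
    ring

theorem rotate_sq_add_sq (A B q : ℝ) :
    (A * Real.cos q - B * Real.sin q) ^ 2 + (A * Real.sin q + B * Real.cos q) ^ 2
      = A ^ 2 + B ^ 2 := by
  linear_combination (A ^ 2 + B ^ 2) * Real.sin_sq_add_cos_sq q

theorem sum_sq_radial {ι : Type*} [Fintype ι] (n m r : ι → ℝ) {A B : ℝ}
    (hn : ∑ i, n i ^ 2 = 1) (hm : ∑ i, n i * m i = 0) :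
    ∑ i, ((A * n i + B * m i) ^ 2 + (B * n i * r i) ^ 2)
      = A ^ 2 + B ^ 2 * (∑ i, m i ^ 2 + ∑ i, n i ^ 2 * r i ^ 2) := by
  calc _ = A ^ 2 * ∑ i, n i ^ 2 + 2 * A * B * ∑ i, n i * m i
        + B ^ 2 * (∑ i, m i ^ 2 + ∑ i, n i ^ 2 * r i ^ 2) := by
        simp only [Finset.mul_sum, ← Finset.sum_add_distrib]
        exact Finset.sum_congr rfl fun i _ => by ring
    _ = _ := by rw [hn, hm]; ring

theorem conformal_factor_identity (a b s c S C : ℝ) (h : s ^ 2 + c ^ 2 = 1)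
    (H : C ^ 2 = S ^ 2 + 1) (hne : c + C ≠ 0) :
    ((c * a * (c + C) - s * (-s * a + S * b)) / (c + C) ^ 2) ^ 2
      + ((C * b * (c + C) - S * (-s * a + S * b)) / (c + C) ^ 2) ^ 2
      = ((c + C) ^ 2)⁻¹ * (a ^ 2 + b ^ 2) := by
  have hA : c * a * (c + C) - s * (-s * a + S * b) = a * (1 + c * C) - s * S * b := by
    linear_combination a * h
  have hB : C * b * (c + C) - S * (-s * a + S * b) = b * (1 + c * C) + s * S * a := by
    linear_combination b * H
  rw [hA, hB]
  field_simp
  linear_combination (a ^ 2 + b ^ 2) * (S ^ 2 * h + (c ^ 2 - 1) * H)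

/-- with `ρ = cos(√λ t) + cosh χ`, the map
`Ψ = (sin(√λ t)/ρ, sinh χ · νᵢ cos φᵢ / ρ, sinh χ · νᵢ sin φᵢ / ρ)` satisfies, at every
point with `∑ νᵢ² = 1` and `ρ > 0` and for every direction `v` tangent to the constraint
(`∑ νᵢ v_{νᵢ} = 0`),
`|DΨ(v)|² = ρ^{-2} (λ v_t² + v_χ² + sinh²χ (∑ v_{νᵢ}² + ∑ νᵢ² v_{φᵢ}²))`. -/
theorem stmt15 (p : ℕ) (hp : 1 ≤ p) (lam : ℝ) (hlam : 0 < lam)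
    (Ψ : ℝ × ℝ × (Fin p → ℝ) × (Fin p → ℝ) → ℝ × (Fin p → ℝ) × (Fin p → ℝ))
    (hΨ : ∀ w : ℝ × ℝ × (Fin p → ℝ) × (Fin p → ℝ),
      Ψ w = (Real.sin (Real.sqrt lam * w.1)
                / (Real.cos (Real.sqrt lam * w.1) + Real.cosh w.2.1),
             fun i => Real.sinh w.2.1 * w.2.2.1 i * Real.cos (w.2.2.2 i)
                / (Real.cos (Real.sqrt lam * w.1) + Real.cosh w.2.1),
             fun i => Real.sinh w.2.1 * w.2.2.1 i * Real.sin (w.2.2.2 i)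
                / (Real.cos (Real.sqrt lam * w.1) + Real.cosh w.2.1))) :
    ∀ (t χ : ℝ) (ν φv : Fin p → ℝ),
      (∑ i, ν i ^ 2) = 1 →
      0 < Real.cos (Real.sqrt lam * t) + Real.cosh χ →
      ∀ v : ℝ × ℝ × (Fin p → ℝ) × (Fin p → ℝ),
        (∑ i, ν i * v.2.2.1 i) = 0 →
        (fderiv ℝ Ψ (t, χ, ν, φv) v).1 ^ 2
          + (∑ i, ((fderiv ℝ Ψ (t, χ, ν, φv) v).2.1 i ^ 2
              + (fderiv ℝ Ψ (t, χ, ν, φv) v).2.2 i ^ 2))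
        = ((Real.cos (Real.sqrt lam * t) + Real.cosh χ) ^ 2)⁻¹ *
            (lam * v.1 ^ 2 + v.2.1 ^ 2
              + Real.sinh χ ^ 2 * ((∑ i, v.2.2.1 i ^ 2) + ∑ i, ν i ^ 2 * v.2.2.2 i ^ 2)) := by
  intro t χ ν φv hν hρ v hv
  have hne : Real.cos (Real.sqrt lam * t) + Real.cosh χ ≠ 0 := hρ.ne'
  have hdiff : DifferentiableAt ℝ Ψ (t, χ, ν, φv) := by
    rw [funext hΨ]
    refine DifferentiableAt.prodMk ?_ (DifferentiableAt.prodMk ?_ ?_)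
    · fun_prop (disch := exact hne)
    all_goals
      rw [differentiableAt_pi]
      intro i
      fun_prop (disch := exact hne)
  have hline : HasDerivAt (fun s : ℝ => Ψ ((t, χ, ν, φv) + s • v))
      (fderiv ℝ Ψ (t, χ, ν, φv) v) 0 := hdiff.hasFDerivAt.hasLineDerivAt v
  have hfst := (hasFDerivAt_fst (𝕜 := ℝ)).comp_hasDerivAt (0 : ℝ) hline
  have hsnd := (hasFDerivAt_snd (𝕜 := ℝ)).comp_hasDerivAt (0 : ℝ) hline
  have hx := hasDerivAt_pi.1 ((hasFDerivAt_fst (𝕜 := ℝ)).comp_hasDerivAt (0 : ℝ) hsnd)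
  have hy := hasDerivAt_pi.1 ((hasFDerivAt_snd (𝕜 := ℝ)).comp_hasDerivAt (0 : ℝ) hsnd)
  obtain ⟨hz', hx', hy'⟩ : _ ∧ _ ∧ _ :=
    ⟨hfst.unique ((hasDerivAt_sin_div t χ _ v.1 v.2.1 hne).congr_of_eventuallyEq
        (Filter.Eventually.of_forall fun s => by simp [hΨ])),
      fun i => (hx i).unique ((hasDerivAt_sinh_mul_cos_div t χ _ v.1 v.2.1 (ν i) (v.2.2.1 i) (φv i)
        (v.2.2.2 i) hne).congr_of_eventuallyEq
        (Filter.Eventually.of_forall fun s => by simp [hΨ])),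
      fun i => (hy i).unique ((hasDerivAt_sinh_mul_sin_div t χ _ v.1 v.2.1 (ν i) (v.2.2.1 i) (φv i)
        (v.2.2.2 i) hne).congr_of_eventuallyEq
        (Filter.Eventually.of_forall fun s => by simp [hΨ]))⟩
  simp only [ContinuousLinearMap.coe_fst', ContinuousLinearMap.coe_snd'] at hz' hx' hy'
  rw [hz']
  simp only [hx', hy', rotate_sq_add_sq]
  rw [sum_sq_radial ν _ _ hν hv, div_pow (Real.sinh χ), div_eq_inv_mul (Real.sinh χ ^ 2)]
  have key := conformal_factor_identity (Real.sqrt lam * v.1) v.2.1 _ _ _ _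
    (Real.sin_sq_add_cos_sq (Real.sqrt lam * t)) (Real.cosh_sq χ) hne
  rw [mul_pow, Real.sq_sqrt hlam.le] at key
  linear_combination key
end

section
/- Fix an integer p ≥ 1, λ > 0 and b₁,…,b_p ∈ ℝ. Let β = (β₁,…,β_{p+1}) ∈ ℝ^{p+1} satisfy the constraint β_{p+1}² − ∑_{i=1}^p (1 − λ b_i²) β_i² = 1, suppose β_i ≠ 0 for i = 1,…,p, and suppose W := β_{p+1}² − ∑_{i=1}^p β_i² > 0. Let V ⊆ ℝ^{2p+2} be the subspace of vectors v = (v_t, v₁, …, v_{p+1}, u₁, …, u_p) satisfying β_{p+1} v_{p+1} = ∑_{i=1}^p (1 − λ b_i²) β_i v_i, and define Q(v) := λ W v_t² − v_{p+1}² + ∑_{i=1}^p ( v_i² + β_i² u_i² ) + ( β_{p+1} v_{p+1} − ∑_{i=1}^p β_i v_i )² / W. Then Q is positive definite on V: Q(v) > 0 for every nonzero v ∈ V. -/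
/-- A Lorentzian form corrected by the square of the pairing with a timelike vector `(B, c)`,
written as a sum of squares. -/
theorem lorentz_add_sq_div_eq {ι : Type*} [Fintype ι] (B w : ℝ) (c x : ι → ℝ) (W : ℝ)
    (hB : B ≠ 0) (hW : W = B ^ 2 - ∑ i, c i ^ 2) (hW0 : W ≠ 0) :
    -w ^ 2 + ∑ i, x i ^ 2 + (B * w - ∑ i, c i * x i) ^ 2 / W
      = (∑ i, (B * x i - w * c i) ^ 2 + (∑ i, c i * (B * x i - w * c i)) ^ 2 / W) / B ^ 2 := by
  have hY : ∑ i, (B * x i - w * c i) ^ 2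
      = B ^ 2 * ∑ i, x i ^ 2 - 2 * B * w * ∑ i, c i * x i + w ^ 2 * ∑ i, c i ^ 2 := by
    simp only [Finset.mul_sum, ← Finset.sum_sub_distrib, ← Finset.sum_add_distrib]
    exact Finset.sum_congr rfl fun i _ => by ring
  have hZ : ∑ i, c i * (B * x i - w * c i) = B * ∑ i, c i * x i - w * ∑ i, c i ^ 2 := by
    simp only [Finset.mul_sum, ← Finset.sum_sub_distrib]
    exact Finset.sum_congr rfl fun i _ => by ring
  rw [hY, hZ, show ∑ i, c i ^ 2 = B ^ 2 - W by linarith]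
  field_simp
  ring

/-- on the constraint surface `β_{p+1}² − ∑ (1 − λbᵢ²)βᵢ² = 1` with all
`βᵢ ≠ 0` (`i = 1,…,p`) and `W := β_{p+1}² − ∑ βᵢ² > 0`, the quadratic form
`Q(v) = λW v_t² − v_{p+1}² + ∑ (vᵢ² + βᵢ² uᵢ²) + (β_{p+1}v_{p+1} − ∑ βᵢvᵢ)²/W` is
positive definite on the subspace `V` of vectors satisfying
`β_{p+1} v_{p+1} = ∑ (1 − λbᵢ²) βᵢ vᵢ`. -/
theorem stmt16 (p : ℕ) (hp : 1 ≤ p) (lam : ℝ) (hlam : 0 < lam) (b : Fin p → ℝ)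
    (β : Fin (p + 1) → ℝ)
    (hconstr : β (Fin.last p) ^ 2
      - (∑ i : Fin p, (1 - lam * b i ^ 2) * β i.castSucc ^ 2) = 1)
    (hβ : ∀ i : Fin p, β i.castSucc ≠ 0)
    (W : ℝ) (hW : W = β (Fin.last p) ^ 2 - ∑ i : Fin p, β i.castSucc ^ 2)
    (hWpos : 0 < W) :
    ∀ (vt : ℝ) (w : Fin (p + 1) → ℝ) (u : Fin p → ℝ),
      (β (Fin.last p) * w (Fin.last p)
        = ∑ i : Fin p, (1 - lam * b i ^ 2) * β i.castSucc * w i.castSucc) →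
      ¬(vt = 0 ∧ w = 0 ∧ u = 0) →
      0 < lam * W * vt ^ 2 - w (Fin.last p) ^ 2
          + (∑ i : Fin p, (w i.castSucc ^ 2 + β i.castSucc ^ 2 * u i ^ 2))
          + (β (Fin.last p) * w (Fin.last p)
              - ∑ i : Fin p, β i.castSucc * w i.castSucc) ^ 2 / W := by
  intro vt w u hw hne
  have hB2 : 0 < β (Fin.last p) ^ 2 := by
    have : 0 ≤ ∑ i : Fin p, β i.castSucc ^ 2 := Finset.sum_nonneg fun i _ => sq_nonneg _
    linarith
  have hB : β (Fin.last p) ≠ 0 := fun h => by simp [h] at hB2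
  have key := lorentz_add_sq_div_eq (β (Fin.last p)) (w (Fin.last p))
    (fun i : Fin p => β i.castSucc) (fun i => w i.castSucc) W hB hW hWpos.ne'
  set Y := ∑ i : Fin p, (β (Fin.last p) * w i.castSucc - w (Fin.last p) * β i.castSucc) ^ 2
  set Z := ∑ i : Fin p,
    β i.castSucc * (β (Fin.last p) * w i.castSucc - w (Fin.last p) * β i.castSucc)
  have hY : 0 ≤ Y := Finset.sum_nonneg fun i _ => sq_nonneg _
  have hZ : 0 ≤ Z ^ 2 / W := by positivity
  have hU : ∀ i : Fin p, 0 ≤ β i.castSucc ^ 2 * u i ^ 2 := fun i => by positivity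
  have hUs : 0 ≤ ∑ i : Fin p, β i.castSucc ^ 2 * u i ^ 2 := Finset.sum_nonneg fun i _ => hU i
  have ht : 0 ≤ lam * W * vt ^ 2 := by positivity
  have hR : 0 ≤ (Y + Z ^ 2 / W) / β (Fin.last p) ^ 2 := by positivity
  rw [Finset.sum_add_distrib]
  by_contra! hle
  have ht0 : lam * W * vt ^ 2 = 0 := by linarith
  have hU0 : ∑ i : Fin p, β i.castSucc ^ 2 * u i ^ 2 = 0 := by linarith
  have hR0 : (Y + Z ^ 2 / W) / β (Fin.last p) ^ 2 = 0 := by linarith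
  have hY0 : Y = 0 := by
    have := (div_eq_zero_iff.mp hR0).resolve_right hB2.ne'
    linarith
  have hprop : ∀ i : Fin p,
      β (Fin.last p) * w i.castSucc = w (Fin.last p) * β i.castSucc := fun i => by
    have := (Finset.sum_eq_zero_iff_of_nonneg fun i _ => sq_nonneg _).mp hY0 i (Finset.mem_univ i)
    linarith [pow_eq_zero_iff two_ne_zero |>.mp this]
  have hlast : w (Fin.last p) = 0 := by
    have h : β (Fin.last p) * (β (Fin.last p) * w (Fin.last p))
        = w (Fin.last p) * ∑ i : Fin p, (1 - lam * b i ^ 2) * β i.castSucc ^ 2 := by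
      rw [hw, Finset.mul_sum, Finset.mul_sum]
      refine Finset.sum_congr rfl fun i _ => ?_
      linear_combination (1 - lam * b i ^ 2) * β i.castSucc * hprop i
    linear_combination h - w (Fin.last p) * hconstr
  refine hne ⟨?_, ?_, ?_⟩
  · simpa [hlam.ne', hWpos.ne'] using ht0
  · funext j
    refine Fin.lastCases hlast (fun i => ?_) j
    simpa [hlast, hB] using hprop i
  · funext i
    have := (Finset.sum_eq_zero_iff_of_nonneg fun i _ => hU i).mp hU0 i (Finset.mem_univ i)
    simpa [hβ i] using this
end
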